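/- arXiv:gr-qc/0308055 — 2 statements merged into one kernel-verified Lean document; each statement's English description precedes it below -/
import Mathlib

section
/- For every positive number r and every real number b, the quantity e^{rβ + bU} A is bounded on (t_p,t_i] × ℝ, where β = ν + (ln α)/2. -/
open MeasureTheory Set

noncomputable section

set_option linter.unusedVariables false

/-- the velocity space `ℝ³` -/
abbrev V3 : Type := ℝ × ℝ × ℝ

/-- partial derivative with respect to the time variable `t` -/
def pt (F : ℝ → ℝ → ℝ) : ℝ → ℝ → ℝ := fun t θ => deriv (fun s => F s θ) t

/-- partial derivative with respect to the space variable `θ` -/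
def pθ (F : ℝ → ℝ → ℝ) : ℝ → ℝ → ℝ := fun t θ => deriv (fun x => F t x) θ

/-- time derivative within `Ici tp` (one-sided at the left endpoint `tp`) -/
def ptW (tp : ℝ) (F : ℝ → ℝ → ℝ) : ℝ → ℝ → ℝ :=
  fun t θ => derivWithin (fun s => F s θ) (Set.Ici tp) t

/-- time derivative of the matter distribution function -/
def ptf (f : ℝ → ℝ → V3 → ℝ) (t θ : ℝ) (v : V3) : ℝ := deriv (fun s => f s θ v) t

/-- one-sided time derivative of the matter distribution function -/
def ptWf (tp : ℝ) (f : ℝ → ℝ → V3 → ℝ) (t θ : ℝ) (v : V3) : ℝ :=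
  derivWithin (fun s => f s θ v) (Set.Ici tp) t

/-- `θ`-derivative of the matter distribution function -/
def pθf (f : ℝ → ℝ → V3 → ℝ) (t θ : ℝ) (v : V3) : ℝ := deriv (fun x => f t x v) θ

/-- derivative in the first velocity variable `v₁` -/
def pv1 (g : V3 → ℝ) (v : V3) : ℝ := deriv (fun y => g (y, v.2.1, v.2.2)) v.1

/-- derivative in the second velocity variable `v₂` -/
def pv2 (g : V3 → ℝ) (v : V3) : ℝ := deriv (fun y => g (v.1, y, v.2.2)) v.2.1

/-- derivative in the third velocity variable `v₃` -/
def pv3 (g : V3 → ℝ) (v : V3) : ℝ := deriv (fun y => g (v.1, v.2.1, y)) v.2.2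

/-- the velocity component `v₀ = −√(α e^{2ν−2U} + α v₁² + α e^{2ν−4U} v₂² + α t⁻² e^{2ν} (v₃ − A v₂)²)` -/
def v0 (α ν U A : ℝ → ℝ → ℝ) (t θ : ℝ) (v : V3) : ℝ :=
  - Real.sqrt (α t θ * Real.exp (2 * ν t θ - 2 * U t θ)
    + α t θ * v.1 ^ 2
    + α t θ * Real.exp (2 * ν t θ - 4 * U t θ) * v.2.1 ^ 2
    + α t θ * (t ^ 2)⁻¹ * Real.exp (2 * ν t θ) * (v.2.2 - A t θ * v.2.1) ^ 2)

/-- `β = ν + (ln α)/2` -/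
def betaF (ν α : ℝ → ℝ → ℝ) : ℝ → ℝ → ℝ := fun t θ => ν t θ + Real.log (α t θ) / 2

/-- the energy `𝓔̃(t) = ∫₀¹ ν_t/(√α t) dθ` -/
def Etilde (ν α : ℝ → ℝ → ℝ) (t : ℝ) : ℝ :=
  ∫ θ in (0:ℝ)..1, pt ν t θ / (Real.sqrt (α t θ) * t)

/-- A `C¹` function oscillates on `[0, 1]` by at most the integral of the absolute value of its
derivative. -/
theorem abs_sub_le_integral_abs_deriv {f : ℝ → ℝ} (hf : ContDiff ℝ 1 f) {x y : ℝ}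
    (hx : x ∈ Icc (0 : ℝ) 1) (hy : y ∈ Icc (0 : ℝ) 1) :
    |f x - f y| ≤ ∫ s in (0 : ℝ)..1, |deriv f s| := by
  have hc : Continuous (deriv f) := hf.continuous_deriv_one
  wlog hyx : y ≤ x generalizing x y
  · rw [abs_sub_comm]
    exact this hy hx (le_of_not_ge hyx)
  rw [← intervalIntegral.integral_deriv_eq_sub
    (fun s _ => (hf.differentiable one_ne_zero).differentiableAt) (hc.intervalIntegrable _ _)]
  exact (intervalIntegral.abs_integral_le_integral_abs hyx).trans
    (intervalIntegral.integral_mono_interval hy.1 hyx hx.2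
      (Filter.Eventually.of_forall fun s => abs_nonneg _) (hc.abs.intervalIntegrable _ _))

/-- The slice of a smooth function on `s × ℝ` at a point of `s` is `C¹`. -/
theorem contDiff_slice {F : ℝ → ℝ → ℝ} {s : Set ℝ} {t : ℝ}
    (hF : ContDiffOn ℝ (⊤ : ℕ∞) (fun p : ℝ × ℝ => F p.1 p.2) (s ×ˢ (univ : Set ℝ)))
    (ht : t ∈ s) : ContDiff ℝ 1 (F t) := by
  have h : ContDiffOn ℝ 1 (fun x : ℝ => F t x) univ :=
    (hF.of_le (by exact_mod_cast le_top)).comp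
      (contDiff_const.prodMk contDiff_id).contDiffOn (fun x _ => ⟨ht, mem_univ x⟩)
  exact contDiffOn_univ.1 h

/-- A weighted bound on the derivative of `A`, together with an oscillation bound on the weight
exponent `U`, controls the oscillation of `A` by the weight at the end point. -/
theorem abs_sub_le_exp_mul_of_weighted_integral {U A : ℝ → ℝ} {K : ℝ}
    (hU : ContDiff ℝ 1 U) (hA : ContDiff ℝ 1 A)
    (hUK : (∫ s in (0 : ℝ)..1, |deriv U s|) ≤ K)
    (hAK : (∫ s in (0 : ℝ)..1, Real.exp (2 * U s) * |deriv A s|) ≤ K) {x y : ℝ}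
    (hx : x ∈ Icc (0 : ℝ) 1) (hy : y ∈ Icc (0 : ℝ) 1) :
    |A x - A y| ≤ Real.exp (2 * K - 2 * U x) * K := by
  have hc : Continuous fun s => |deriv A s| := hA.continuous_deriv_one.abs
  have hcU : Continuous fun s => Real.exp (2 * U s) :=
    Real.continuous_exp.comp (continuous_const.mul hU.continuous)
  calc |A x - A y| ≤ ∫ s in (0 : ℝ)..1, |deriv A s| := abs_sub_le_integral_abs_deriv hA hx hy
    _ ≤ ∫ s in (0 : ℝ)..1,
          Real.exp (2 * K - 2 * U x) * (Real.exp (2 * U s) * |deriv A s|) := by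
        refine intervalIntegral.integral_mono_on zero_le_one (hc.intervalIntegrable _ _)
          ((continuous_const.mul (hcU.mul hc)).intervalIntegrable _ _) fun s hs => ?_
        rw [← mul_assoc, ← Real.exp_add]
        refine le_mul_of_one_le_left (abs_nonneg _) (Real.one_le_exp ?_)
        have := (abs_le.1 ((abs_sub_le_integral_abs_deriv hU hx hs).trans hUK)).2
        linarith
    _ = Real.exp (2 * K - 2 * U x) *
          ∫ s in (0 : ℝ)..1, Real.exp (2 * U s) * |deriv A s| :=
        intervalIntegral.integral_const_mul _ _
    _ ≤ Real.exp (2 * K - 2 * U x) * K := by gcongr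

/-- The square of `e^{r β + b U} A` in terms of `α`, `ν`, `U` and `A`. -/
theorem sq_exp_betaF_mul {U A ν α : ℝ → ℝ → ℝ} {t θ : ℝ} (hα : 0 < α t θ) (r b : ℝ) :
    (Real.exp (r * betaF ν α t θ + b * U t θ) * A t θ) ^ 2 =
      α t θ ^ (r / 2) *
        (α t θ ^ (r / 2) * Real.exp (2 * r * ν t θ + 2 * b * U t θ) * A t θ ^ 2) := by
  have h : Real.exp (r * betaF ν α t θ + b * U t θ) ^ 2 =
      α t θ ^ (r / 2) * (α t θ ^ (r / 2) * Real.exp (2 * r * ν t θ + 2 * b * U t θ)) := by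
    rw [Real.rpow_def_of_pos hα, ← Real.exp_nat_mul, ← Real.exp_add, ← Real.exp_add, betaF]
    congr 1
    push_cast
    ring
  rw [mul_pow, h]
  ring

theorem exp_rbeta_bU_A_bounded
    (tp ti : ℝ) (htp : 0 < tp) (hti : tp < ti)
    (U A ν α : ℝ → ℝ → ℝ)
    (hUsm : ContDiffOn ℝ (⊤ : ℕ∞) (fun p : ℝ × ℝ => U p.1 p.2) (Ioc tp ti ×ˢ (univ : Set ℝ)))
    (hAsm : ContDiffOn ℝ (⊤ : ℕ∞) (fun p : ℝ × ℝ => A p.1 p.2) (Ioc tp ti ×ˢ (univ : Set ℝ)))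
    (hνsm : ContDiffOn ℝ (⊤ : ℕ∞) (fun p : ℝ × ℝ => ν p.1 p.2) (Ioc tp ti ×ˢ (univ : Set ℝ)))
    (hαsm : ContDiffOn ℝ (⊤ : ℕ∞) (fun p : ℝ × ℝ => α p.1 p.2) (Ioc tp ti ×ˢ (univ : Set ℝ)))
    (hUper : ∀ t θ, U t (θ + 1) = U t θ)
    (hAper : ∀ t θ, A t (θ + 1) = A t θ)
    (hνper : ∀ t θ, ν t (θ + 1) = ν t θ)
    (hαper : ∀ t θ, α t (θ + 1) = α t θ)
    (hαpos : ∀ t ∈ Ioc tp ti, ∀ θ : ℝ, 0 < α t θ)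
    (h1 : ∀ r : ℝ, 0 < r → ∀ lam : ℝ, ∃ C : ℝ, ∀ t ∈ Ioc tp ti, ∀ θ : ℝ,
      α t θ ^ (r / 2) * Real.exp (2 * r * ν t θ + lam * U t θ) * A t θ ^ 2 ≤ C)
    (h2 : ∀ b : ℝ, ∃ C : ℝ, ∀ t ∈ Ioc tp ti, ∀ θ : ℝ,
      Real.exp (betaF ν α t θ + b * U t θ) ≤ C)
    (h3 : ∃ θb ∈ Icc (0:ℝ) 1, ∃ M : ℝ, ∀ t ∈ Ioc tp ti, α t θb ≤ M)
    (h4 : ∃ C₄ : ℝ, 0 < C₄ ∧ ∀ t ∈ Ioc tp ti,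
      (∫ θ in (0:ℝ)..1, |pθ (betaF ν α) t θ|) < C₄
      ∧ (∫ θ in (0:ℝ)..1, |pθ U t θ|) < C₄
      ∧ (∫ θ in (0:ℝ)..1, Real.exp (2 * U t θ) * |pθ A t θ|) < C₄) :
    ∀ r : ℝ, 0 < r → ∀ b : ℝ, ∃ C : ℝ, ∀ t ∈ Ioc tp ti, ∀ θ : ℝ,
      |Real.exp (r * betaF ν α t θ + b * U t θ) * A t θ| ≤ C := by
  intro r hr b
  obtain ⟨θb, hθb, M, hM⟩ := h3
  obtain ⟨K, hK, h4⟩ := h4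
  obtain ⟨C₁, hC₁⟩ := h1 r hr (2 * b)
  obtain ⟨C₂, hC₂⟩ := h2 ((b - 2) / r)
  refine ⟨Real.exp ((r + |b|) * K) * √(M ^ (r / 2) * C₁) + C₂ ^ r * Real.exp (2 * K) * K,
    fun t ht θ => ?_⟩
  have hper : Function.Periodic
      (fun θ => |Real.exp (r * betaF ν α t θ + b * U t θ) * A t θ|) 1 := fun θ => by
    simp only [betaF, hUper, hAper, hνper, hαper]
  obtain ⟨x, hx, hθx⟩ := hper.exists_mem_Ico₀ one_pos θ
  have hx : x ∈ Icc (0 : ℝ) 1 := Ico_subset_Icc_self hx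
  refine hθx.trans_le ?_
  obtain ⟨hβK, hUK, hAK⟩ := h4 t ht
  have hU := contDiff_slice hUsm ht
  have hA := contDiff_slice hAsm ht
  have hβ : ContDiff ℝ 1 (betaF ν α t) := (contDiff_slice hνsm ht).add
    (((contDiff_slice hαsm ht).log fun θ => (hαpos t ht θ).ne').div_const 2)
  have hAosc := abs_sub_le_exp_mul_of_weighted_integral hU hA hUK.le hAK.le hx hθb
  have hβosc := (abs_sub_le_integral_abs_deriv hβ hx hθb).trans hβK.le
  have hUosc := (abs_sub_le_integral_abs_deriv hU hx hθb).trans hUK.le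
  have hbase : |Real.exp (r * betaF ν α t θb + b * U t θb) * A t θb| ≤ √(M ^ (r / 2) * C₁) := by
    refine Real.abs_le_sqrt ?_
    rw [sq_exp_betaF_mul (hαpos t ht θb)]
    have hα := hαpos t ht θb
    exact mul_le_mul (Real.rpow_le_rpow hα.le (hM t ht) (by positivity)) (hC₁ t ht θb)
      (by positivity) (Real.rpow_nonneg (hα.le.trans (hM t ht)) _)
  have hexp : Real.exp (r * betaF ν α t x + b * U t x) ≤
      Real.exp ((r + |b|) * K) * Real.exp (r * betaF ν α t θb + b * U t θb) := by
    rw [← Real.exp_add, Real.exp_le_exp]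
    have hb : b * (U t x - U t θb) ≤ |b| * K :=
      (le_abs_self _).trans (by rw [abs_mul]; gcongr)
    have hr' : r * (betaF ν α t x - betaF ν α t θb) ≤ r * K := by
      gcongr
      exact (le_abs_self _).trans hβosc
    linarith
  have hweight : Real.exp (r * betaF ν α t x + b * U t x) * Real.exp (2 * K - 2 * U t x) ≤
      C₂ ^ r * Real.exp (2 * K) := by
    have hpow : Real.exp (r * betaF ν α t x + b * U t x) * Real.exp (2 * K - 2 * U t x) =
        Real.exp (betaF ν α t x + (b - 2) / r * U t x) ^ r * Real.exp (2 * K) := by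
      rw [← Real.exp_mul, ← Real.exp_add, ← Real.exp_add]
      congr 1
      field_simp
      ring
    rw [hpow]
    gcongr
    exact hC₂ t ht x
  rw [abs_mul, Real.abs_exp] at hbase ⊢
  calc Real.exp (r * betaF ν α t x + b * U t x) * |A t x|
      ≤ Real.exp (r * betaF ν α t x + b * U t x) * (|A t θb| + |A t x - A t θb|) := by
        gcongr
        linarith [abs_sub_abs_le_abs_sub (A t x) (A t θb)]
    _ ≤ Real.exp (r * betaF ν α t x + b * U t x) *
          (|A t θb| + Real.exp (2 * K - 2 * U t x) * K) := by gcongr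
    _ = Real.exp (r * betaF ν α t x + b * U t x) * |A t θb| +
          Real.exp (r * betaF ν α t x + b * U t x) * Real.exp (2 * K - 2 * U t x) * K := by ring
    _ ≤ Real.exp ((r + |b|) * K) * Real.exp (r * betaF ν α t θb + b * U t θb) * |A t θb| +
          C₂ ^ r * Real.exp (2 * K) * K := by gcongr
    _ ≤ _ := by
        rw [mul_assoc]
        gcongr
end
end

section
/- The integral ∫_{t_p}^{t_i} max_{θ∈[0,1]} [ e^{2β(σ,θ) − 4U(σ,θ)} (J(σ,θ))² ] dσ is finite; equivalently, ∫_t^{t_i} max_{θ∈[0,1]} [e^{2β − 4U} J²](σ,·) dσ is bounded uniformly for t ∈ (t_p,t_i]. -/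
open MeasureTheory Set

noncomputable section

set_option linter.unusedVariables false

/-- The interval integral of any function dominated by a nonnegative integrable function is
bounded by the integral of the latter, whether or not the former is integrable. -/
theorem integral_le_of_le_of_nonneg {F G : ℝ → ℝ} {a b : ℝ} (hab : a ≤ b)
    (hG : IntervalIntegrable G volume a b) (hG0 : ∀ x ∈ Icc a b, 0 ≤ G x)
    (hFG : ∀ x ∈ Icc a b, F x ≤ G x) :
    ∫ x in a..b, F x ≤ ∫ x in a..b, G x := by
  by_cases hF : IntervalIntegrable F volume a b
  · exact intervalIntegral.integral_mono_on hab hF hG hFG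
  · rw [intervalIntegral.integral_undef hF]
    exact intervalIntegral.integral_nonneg hab hG0

/-- A nonpositive logarithmic derivative of a positive continuous function is integrable. -/
theorem intervalIntegrable_logDeriv_of_nonpos {a : ℝ → ℝ} {s t : ℝ} (hst : s ≤ t)
    (hcont : ContinuousOn a (Icc s t)) (hpos : ∀ x ∈ Icc s t, 0 < a x)
    (hdiff : ∀ x ∈ Ioo s t, DifferentiableAt ℝ a x)
    (hnonpos : ∀ x ∈ Ioo s t, deriv a x / a x ≤ 0) :
    IntervalIntegrable (fun x => deriv a x / a x) volume s t := by
  have h : IntegrableOn (fun x => -(deriv a x / a x)) (Ioc s t) := by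
    refine intervalIntegral.integrableOn_deriv_of_nonneg
      (g := fun x => -Real.log (a x)) ?_ ?_ ?_
    · exact (hcont.log fun x hx => (hpos x hx).ne').neg
    · intro x hx
      exact ((hdiff x hx).hasDerivAt.log (hpos x (Ioo_subset_Icc_self hx)).ne').neg
    · intro x hx
      linarith [hnonpos x hx]
  rw [intervalIntegrable_iff_integrableOn_Ioc_of_le hst]
  simpa using h.neg

/-- The function `e^{2β}` equals `α e^{2ν}` wherever `α` is positive. -/
theorem exp_two_betaF_sub {ν α : ℝ → ℝ → ℝ} {t θ : ℝ} (h : 0 < α t θ) (x : ℝ) :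
    Real.exp (2 * betaF ν α t θ - x) = α t θ * Real.exp (2 * ν t θ - x) := by
  have h' : 2 * betaF ν α t θ - x = Real.log (α t θ) + (2 * ν t θ - x) := by
    unfold betaF; ring
  rw [h', Real.exp_add, Real.exp_log h]

/-- A weighted square `e^{2β - 4U} J²` at one point is controlled by its value at another point
when `β`, `U`, `J` differ by at most `c` and the weight is at most `D`. -/
theorem exp_mul_sq_le_of_abs_sub_le {β₁ β₂ U₁ U₂ J₁ J₂ c D : ℝ}
    (hβ : |β₁ - β₂| ≤ c) (hU : |U₁ - U₂| ≤ c) (hJ : |J₁ - J₂| ≤ c)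
    (hD : Real.exp (2 * β₁ - 4 * U₁) ≤ D) :
    Real.exp (2 * β₁ - 4 * U₁) * J₁ ^ 2
      ≤ 2 * Real.exp (6 * c) * (Real.exp (2 * β₂ - 4 * U₂) * J₂ ^ 2) + 2 * D * c ^ 2 := by
  rw [abs_le] at hβ hU
  have hexp : Real.exp (2 * β₁ - 4 * U₁) ≤ Real.exp (6 * c) * Real.exp (2 * β₂ - 4 * U₂) := by
    rw [← Real.exp_add, Real.exp_le_exp]
    linarith
  have hsq : (J₁ - J₂) ^ 2 ≤ c ^ 2 := sq_le_sq' (abs_le.1 hJ).1 (abs_le.1 hJ).2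
  have hJ₁ : J₁ ^ 2 ≤ 2 * J₂ ^ 2 + 2 * c ^ 2 := by
    nlinarith [sq_nonneg (J₁ - 2 * J₂)]
  calc Real.exp (2 * β₁ - 4 * U₁) * J₁ ^ 2
      ≤ Real.exp (2 * β₁ - 4 * U₁) * (2 * J₂ ^ 2 + 2 * c ^ 2) := by gcongr
    _ = 2 * (Real.exp (2 * β₁ - 4 * U₁) * J₂ ^ 2)
          + 2 * Real.exp (2 * β₁ - 4 * U₁) * c ^ 2 := by ring
    _ ≤ 2 * (Real.exp (6 * c) * Real.exp (2 * β₂ - 4 * U₂) * J₂ ^ 2) + 2 * D * c ^ 2 := by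
        gcongr
    _ = _ := by ring

theorem integral_sup_J_term_bounded
    (tp ti : ℝ) (htp : 0 < tp) (hti : tp < ti)
    (U A ν α J K : ℝ → ℝ → ℝ) (f : ℝ → ℝ → V3 → ℝ)
    (hUsm : ContDiffOn ℝ (⊤ : ℕ∞) (fun p : ℝ × ℝ => U p.1 p.2) (Ioc tp ti ×ˢ (univ : Set ℝ)))
    (hAsm : ContDiffOn ℝ (⊤ : ℕ∞) (fun p : ℝ × ℝ => A p.1 p.2) (Ioc tp ti ×ˢ (univ : Set ℝ)))
    (hνsm : ContDiffOn ℝ (⊤ : ℕ∞) (fun p : ℝ × ℝ => ν p.1 p.2) (Ioc tp ti ×ˢ (univ : Set ℝ)))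
    (hαsm : ContDiffOn ℝ (⊤ : ℕ∞) (fun p : ℝ × ℝ => α p.1 p.2) (Ioc tp ti ×ˢ (univ : Set ℝ)))
    (hJsm : ContDiffOn ℝ (⊤ : ℕ∞) (fun p : ℝ × ℝ => J p.1 p.2) (Ioc tp ti ×ˢ (univ : Set ℝ)))
    (hKsm : ContDiffOn ℝ (⊤ : ℕ∞) (fun p : ℝ × ℝ => K p.1 p.2) (Ioc tp ti ×ˢ (univ : Set ℝ)))
    (hfsm : ContDiffOn ℝ (⊤ : ℕ∞) (fun p : ℝ × ℝ × V3 => f p.1 p.2.1 p.2.2) (Ioc tp ti ×ˢ (univ : Set (ℝ × V3))))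
    (hUper : ∀ t θ, U t (θ + 1) = U t θ)
    (hAper : ∀ t θ, A t (θ + 1) = A t θ)
    (hνper : ∀ t θ, ν t (θ + 1) = ν t θ)
    (hαper : ∀ t θ, α t (θ + 1) = α t θ)
    (hJper : ∀ t θ, J t (θ + 1) = J t θ)
    (hKper : ∀ t θ, K t (θ + 1) = K t θ)
    (hfper : ∀ t θ v, f t (θ + 1) v = f t θ v)
    (hαpos : ∀ t ∈ Ioc tp ti, ∀ θ : ℝ, 0 < α t θ)
    (hfnn : ∀ t ∈ Ioc tp ti, ∀ (θ : ℝ) (v : V3), 0 ≤ f t θ v)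
    (hfsupp : ∀ t ∈ Ioc tp ti, ∃ R : ℝ, ∀ (θ : ℝ) (v : V3), R < ‖v‖ → f t θ v = 0)
    (halt :
      ∀ t ∈ Ioc tp ti, ∀ θ : ℝ,
      (pt α t θ) / α t θ
        = - (α t θ * Real.exp (2 * ν t θ - 4 * U t θ) * J t θ ^ 2 / t)
          - α t θ * Real.exp (2 * ν t θ) * (K t θ - A t θ * J t θ) ^ 2 / t ^ 3
          - 2 * (α t θ * Real.sqrt (α t θ)) * Real.exp (2 * ν t θ)
            * ∫ v : V3, f t θ v
                * (Real.exp (-2 * U t θ) + Real.exp (-4 * U t θ) * v.2.1 ^ 2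
                    + (t ^ 2)⁻¹ * (v.2.2 - A t θ * v.2.1) ^ 2)
                / |v0 α ν U A t θ v|)
    (h1 : ∃ θb ∈ Icc (0:ℝ) 1, ∃ C : ℝ, ∀ t ∈ Ioc tp ti,
      |∫ σ in t..ti, pt α σ θb / α σ θb| ≤ C)
    (h2 : ∀ b : ℝ, ∃ C : ℝ, ∀ t ∈ Ioc tp ti, ∀ θ : ℝ,
      Real.exp (betaF ν α t θ + b * U t θ) ≤ C)
    (h3 : ∃ C₄ : ℝ, 0 < C₄ ∧ ∀ t ∈ Ioc tp ti, ∀ θ₁ ∈ Icc (0:ℝ) 1, ∀ θ₂ ∈ Icc (0:ℝ) 1,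
      |betaF ν α t θ₁ - betaF ν α t θ₂| < C₄ ∧ |U t θ₁ - U t θ₂| < C₄
      ∧ |J t θ₁ - J t θ₂| < C₄) :
    ∃ C : ℝ, ∀ t ∈ Ioc tp ti,
      (∫ σ in t..ti,
        sSup ((fun θ => Real.exp (2 * betaF ν α σ θ - 4 * U σ θ) * J σ θ ^ 2) '' Icc (0:ℝ) 1)) ≤ C := by
  obtain ⟨θb, hθb, C, hC⟩ := h1
  obtain ⟨B, hB⟩ := h2 (-2)
  obtain ⟨c, hc, hosc⟩ := h3
  set q : ℝ → ℝ := fun σ => pt α σ θb / α σ θb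
  have hJq : ∀ σ ∈ Ioc tp ti,
      Real.exp (2 * betaF ν α σ θb - 4 * U σ θb) * J σ θb ^ 2 ≤ σ * -q σ := by
    intro σ hσ
    have hσ0 : 0 < σ := htp.trans hσ.1
    have hα := hαpos σ hσ θb
    have hint : 0 ≤ ∫ v : V3, f σ θb v
        * (Real.exp (-2 * U σ θb) + Real.exp (-4 * U σ θb) * v.2.1 ^ 2
            + (σ ^ 2)⁻¹ * (v.2.2 - A σ θb * v.2.1) ^ 2) / |v0 α ν U A σ θb v| :=
      integral_nonneg fun v =>
        div_nonneg (mul_nonneg (hfnn σ hσ θb v) (by positivity)) (abs_nonneg _)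
    have hmatter := mul_nonneg (show 0 ≤ 2 * (α σ θb * Real.sqrt (α σ θb))
      * Real.exp (2 * ν σ θb) by positivity) hint
    have hK : 0 ≤ α σ θb * Real.exp (2 * ν σ θb) * (K σ θb - A σ θb * J σ θb) ^ 2 / σ ^ 3 := by
      positivity
    have heq := halt σ hσ θb
    rw [exp_two_betaF_sub hα, mul_comm σ, ← div_le_iff₀ hσ0]
    change _ ≤ -(pt α σ θb / α σ θb)
    linarith
  have hq0 : ∀ σ ∈ Ioc tp ti, 0 ≤ -q σ := fun σ hσ =>
    nonneg_of_mul_nonneg_right ((by positivity : (0:ℝ) ≤ _).trans (hJq σ hσ))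
      (htp.trans hσ.1)
  set M : ℝ := 2 * Real.exp (6 * c) * ti with hM
  have hti0 : 0 < ti := htp.trans hti
  have hM0 : 0 ≤ M := by positivity
  set N : ℝ := 2 * B ^ 2 * c ^ 2
  have hN0 : 0 ≤ N := by positivity
  have hsup : ∀ σ ∈ Ioc tp ti,
      sSup ((fun θ => Real.exp (2 * betaF ν α σ θ - 4 * U σ θ) * J σ θ ^ 2) '' Icc (0:ℝ) 1)
        ≤ M * -q σ + N := by
    intro σ hσ
    refine csSup_le ((nonempty_Icc.2 zero_le_one).image _) ?_
    rintro _ ⟨θ, hθ, rfl⟩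
    obtain ⟨hβ, hU, hJ⟩ := hosc σ hσ θ hθ θb hθb
    have hD : Real.exp (2 * betaF ν α σ θ - 4 * U σ θ) ≤ B ^ 2 := by
      have hsq : Real.exp (2 * betaF ν α σ θ - 4 * U σ θ)
          = Real.exp (betaF ν α σ θ + -2 * U σ θ) ^ 2 := by
        rw [← Real.exp_nat_mul]
        congr 1
        push_cast
        ring
      rw [hsq]
      exact pow_le_pow_left₀ (Real.exp_pos _).le (hB σ hσ θ) 2
    refine (exp_mul_sq_le_of_abs_sub_le hβ.le hU.le hJ.le hD).trans ?_
    have hle : Real.exp (2 * betaF ν α σ θb - 4 * U σ θb) * J σ θb ^ 2 ≤ ti * -q σ :=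
      (hJq σ hσ).trans (mul_le_mul_of_nonneg_right hσ.2 (hq0 σ hσ))
    have := mul_le_mul_of_nonneg_left hle (show 0 ≤ 2 * Real.exp (6 * c) by positivity)
    rw [hM, mul_assoc _ ti]
    linarith
  refine ⟨M * C + N * (ti - tp), fun t ht => ?_⟩
  have hsub : Icc t ti ⊆ Ioc tp ti := fun x hx => ⟨ht.1.trans_le hx.1, hx.2⟩
  have hqint : IntervalIntegrable q volume t ti := by
    refine intervalIntegrable_logDeriv_of_nonpos (a := fun s => α s θb) ht.2 ?_
      (fun x hx => hαpos x (hsub hx) θb) ?_ ?_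
    · exact hαsm.continuousOn.comp (f := fun s : ℝ => (s, θb)) (by fun_prop)
        fun x hx => ⟨hsub hx, mem_univ _⟩
    · intro x hx
      have hnhds : Ioc tp ti ×ˢ (univ : Set ℝ) ∈ nhds (x, θb) :=
        prod_mem_nhds (Ioc_mem_nhds (ht.1.trans hx.1) hx.2) Filter.univ_mem
      have hd := (hαsm.contDiffAt hnhds).differentiableAt (by simp)
      exact hd.comp (f := fun s : ℝ => (s, θb)) x (by fun_prop)
    · intro x hx
      exact neg_nonneg.1 (hq0 x (hsub (Ioo_subset_Icc_self hx)))
  have hGint : IntervalIntegrable (fun σ => M * -q σ) volume t ti := hqint.neg.const_mul M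
  calc _ ≤ ∫ σ in t..ti, (M * -q σ + N) :=
        integral_le_of_le_of_nonneg ht.2 (hGint.add intervalIntegrable_const)
          (fun x hx => add_nonneg (mul_nonneg hM0 (hq0 x (hsub hx))) hN0)
          fun x hx => hsup x (hsub hx)
    _ = M * -(∫ σ in t..ti, q σ) + N * (ti - t) := by
        rw [intervalIntegral.integral_add hGint intervalIntegrable_const,
          intervalIntegral.integral_const_mul, intervalIntegral.integral_neg,
          intervalIntegral.integral_const, smul_eq_mul, mul_comm N]
    _ ≤ M * C + N * (ti - tp) := by
        have hCt := (neg_le_abs _).trans (hC t ht)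
        gcongr
        exact ht.1.le
end
end
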